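/- arXiv:cs/0602058 — 6 statements merged into one kernel-verified Lean document; each statement's English description precedes it below -/
import Mathlib

section
/- Let Y be a finite subset of the nonzero reals that is closed under negation, together with possibly the point 0, and let p : ℝ → ℝ be a function with p(y) > 0 for all y ∈ Y and ∑_{y ∈ Y} p(y) = 1 (the transition probabilities p(y|0) of a binary-input symmetric-output memoryless channel, with p(y|1) = p(-y)). Define the channel capacity C = 1 − ∑_{y ∈ Y} p(y)·log₂((p(y) + p(−y))/p(y)), the Bhattacharyya parameter γ = ∑_{y ∈ Y} √(p(y)·p(−y)), the Bhattacharyya rate B = 1 − γ, and the cutoff rate R₀ = 1 − log₂(1 + γ). Then C ≥ B ≥ R₀. -/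
open scoped BigOperators

theorem sinh_mul_le_sinh_mul {x y : ℝ} (hx : 0 < x) (hxy : x ≤ y) :
    Real.sinh x * y ≤ Real.sinh y * x := by
  have hconv : ConvexOn ℝ (Set.Ici 0) Real.sinh := by
    refine MonotoneOn.convexOn_of_deriv (convex_Ici 0) Real.continuous_sinh.continuousOn
      Real.differentiable_sinh.differentiableOn ?_
    rw [Real.deriv_sinh]
    exact Real.cosh_strictMonoOn.monotoneOn.mono interior_subset
  have hy : 0 < y := hx.trans_le hxy
  have h := hconv.secant_mono (a := 0) (by simp) (Set.mem_Ici.2 hx.le) (Set.mem_Ici.2 hy.le)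
    hx.ne' hy.ne' hxy
  simp only [Real.sinh_zero, sub_zero] at h
  rwa [div_le_div_iff₀ hx hy] at h

/-- The natural-log entropy of the distribution proportional to `(exp u, exp (-u))`, minus
`log 2` times its Bhattacharyya parameter. -/
noncomputable def entropyGap (u : ℝ) : ℝ :=
  Real.log (2 * Real.cosh u) - u * (Real.sinh u / Real.cosh u) - Real.log 2 / Real.cosh u

theorem hasDerivAt_entropyGap (u : ℝ) :
    HasDerivAt entropyGap ((Real.log 2 * Real.sinh u - u) / Real.cosh u ^ 2) u := by
  have hc := Real.cosh_pos u
  have h1 := ((Real.hasDerivAt_cosh u).const_mul 2).log (by positivity)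
  have h2 := (hasDerivAt_id u).mul ((Real.hasDerivAt_sinh u).div (Real.hasDerivAt_cosh u) hc.ne')
  have h3 := (hasDerivAt_const u (Real.log 2)).div (Real.hasDerivAt_cosh u) hc.ne'
  refine ((h1.sub h2).sub h3).congr_deriv ?_
  have hsq := Real.cosh_sq u
  simp only [id, Pi.div_apply]
  field_simp
  linear_combination (-u) * hsq

theorem entropyGap_le_exp {v : ℝ} (hv : 0 ≤ v) :
    entropyGap v ≤ Real.exp (-v) + 2 * (v * Real.exp (-v)) := by
  have hc := Real.cosh_pos v
  have hb := Real.exp_pos (-v)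
  have hb1 : Real.exp (-v) ≤ 1 := Real.exp_le_one_iff.2 (by linarith)
  have hc1 := Real.one_le_cosh v
  have hsc : Real.sinh v = Real.cosh v - Real.exp (-v) := by
    rw [Real.sinh_eq, Real.cosh_eq]; ring
  have hlog : Real.log (2 * Real.cosh v) ≤ v + Real.exp (-v) := by
    have h : 2 * Real.cosh v = Real.exp v * (1 + Real.exp (-v) * Real.exp (-v)) := by
      have : Real.exp v * Real.exp (-v) = 1 := by rw [← Real.exp_add]; simp
      rw [Real.cosh_eq]
      linear_combination (-Real.exp (-v)) * this
    rw [h, Real.log_mul (Real.exp_pos v).ne' (by positivity), Real.log_exp]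
    have := Real.log_le_sub_one_of_pos (x := 1 + Real.exp (-v) * Real.exp (-v)) (by positivity)
    nlinarith
  have hlast : 0 ≤ Real.log 2 / Real.cosh v := div_nonneg (Real.log_nonneg (by norm_num)) hc.le
  have hdiv : Real.exp (-v) / Real.cosh v ≤ Real.exp (-v) := div_le_self hb.le hc1
  have htanh : Real.sinh v / Real.cosh v = 1 - Real.exp (-v) / Real.cosh v := by
    rw [hsc, sub_div, div_self hc.ne']
  rw [entropyGap, htanh]
  nlinarith [mul_le_mul_of_nonneg_left hdiv hv, mul_nonneg hv hb.le]

theorem entropyGap_nonpos {u : ℝ} (hu : 0 ≤ u) : entropyGap u ≤ 0 := by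
  rcases hu.eq_or_lt with rfl | hu
  · simp [entropyGap]
  have hcont : Continuous entropyGap :=
    continuous_iff_continuousAt.2 fun x => (hasDerivAt_entropyGap x).continuousAt
  have hdiff : Differentiable ℝ entropyGap := fun x => (hasDerivAt_entropyGap x).differentiableAt
  have hl : 0 < Real.log 2 := Real.log_pos (by norm_num)
  rcases le_total (Real.log 2 * Real.sinh u) u with h | h
  · have hanti : AntitoneOn entropyGap (Set.Icc 0 u) := by
      refine antitoneOn_of_deriv_nonpos (convex_Icc 0 u) hcont.continuousOn
        hdiff.differentiableOn fun x hx => ?_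
      rw [interior_Icc] at hx
      rw [(hasDerivAt_entropyGap x).deriv]
      refine div_nonpos_of_nonpos_of_nonneg ?_ (sq_nonneg _)
      have := sinh_mul_le_sinh_mul hx.1 hx.2.le
      have h1 := mul_le_mul_of_nonneg_left this hl.le
      have h2 := mul_le_mul_of_nonneg_right h hx.1.le
      have h3 : (Real.log 2 * Real.sinh x) * u ≤ x * u := by linarith
      linarith [le_of_mul_le_mul_right h3 hu]
    have h0 := hanti (Set.left_mem_Icc.2 hu.le) (Set.right_mem_Icc.2 hu.le) hu.le
    simpa [entropyGap] using h0
  · have hmono : MonotoneOn entropyGap (Set.Ici u) := by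
      refine monotoneOn_of_deriv_nonneg (convex_Ici u) hcont.continuousOn
        hdiff.differentiableOn fun x hx => ?_
      rw [interior_Ici] at hx
      have hx : u < x := hx
      rw [(hasDerivAt_entropyGap x).deriv]
      refine div_nonneg ?_ (sq_nonneg _)
      have := sinh_mul_le_sinh_mul hu hx.le
      have h1 := mul_le_mul_of_nonneg_left this hl.le
      have h2 := mul_le_mul_of_nonneg_right h (hu.trans hx).le
      have h3 : x * u ≤ (Real.log 2 * Real.sinh x) * u := by linarith
      linarith [le_of_mul_le_mul_right h3 hu]
    have hlim : Filter.Tendsto (fun v : ℝ => Real.exp (-v) + 2 * (v * Real.exp (-v)))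
        Filter.atTop (nhds 0) := by
      have h0 := Real.tendsto_pow_mul_exp_neg_atTop_nhds_zero 0
      have h1 := Real.tendsto_pow_mul_exp_neg_atTop_nhds_zero 1
      simpa using h0.add (h1.const_mul 2)
    refine ge_of_tendsto hlim ?_
    filter_upwards [Filter.eventually_ge_atTop u] with v hv
    exact (hmono Set.self_mem_Ici hv hv).trans (entropyGap_le_exp (hu.le.trans hv))

theorem entropyGap_neg (u : ℝ) : entropyGap (-u) = entropyGap u := by
  simp [entropyGap, neg_div]

/-- Homogeneous form of the bound `h₂(x) ≤ 2√(x(1-x))` on the binary entropy. -/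
theorem mul_logb_add_mul_logb_le_two_mul_sqrt {a b : ℝ} (ha : 0 < a) (hb : 0 < b) :
    a * Real.logb 2 ((a + b) / a) + b * Real.logb 2 ((b + a) / b) ≤ 2 * √(a * b) := by
  obtain ⟨s, rfl⟩ : ∃ s, Real.exp s = a := ⟨Real.log a, Real.exp_log ha⟩
  obtain ⟨t, rfl⟩ : ∃ t, Real.exp t = b := ⟨Real.log b, Real.exp_log hb⟩
  obtain ⟨u, m, rfl, rfl⟩ : ∃ u m, s = m + u ∧ t = m - u :=
    ⟨(s - t) / 2, (s + t) / 2, by ring, by ring⟩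
  have hl : 0 < Real.log 2 := Real.log_pos (by norm_num)
  have hc := Real.cosh_pos u
  have hgap : entropyGap u ≤ 0 := by
    rcases le_total 0 u with h | h
    · exact entropyGap_nonpos h
    · rw [← entropyGap_neg]
      exact entropyGap_nonpos (neg_nonneg.2 h)
  have hsqrt : √(Real.exp (m + u) * Real.exp (m - u)) = Real.exp m := by
    rw [← Real.exp_add, show m + u + (m - u) = m + m by ring, Real.exp_add,
      Real.sqrt_mul_self (Real.exp_pos m).le]
  have hsum : Real.exp (m + u) + Real.exp (m - u) = Real.exp m * (2 * Real.cosh u) := by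
    rw [Real.cosh_eq, sub_eq_add_neg, Real.exp_add, Real.exp_add]; ring
  have hlog : Real.log (Real.exp m * (2 * Real.cosh u)) = m + Real.log (2 * Real.cosh u) := by
    rw [Real.log_mul (Real.exp_pos m).ne' (by positivity), Real.log_exp]
  have hne : Real.exp m * (2 * Real.cosh u) ≠ 0 := by positivity
  rw [hsqrt, add_comm (Real.exp (m - u)), hsum, Real.logb, Real.logb,
    Real.log_div hne (Real.exp_pos _).ne', Real.log_div hne (Real.exp_pos _).ne', hlog,
    Real.log_exp, Real.log_exp, ← mul_div_assoc, ← mul_div_assoc, ← add_div, div_le_iff₀ hl]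
  have hmul := mul_nonpos_of_nonneg_of_nonpos
    (show 0 ≤ 2 * Real.exp m * Real.cosh u by positivity) hgap
  have hgap_eq : 2 * Real.exp m * Real.cosh u * entropyGap u =
      2 * Real.exp m * Real.cosh u * Real.log (2 * Real.cosh u)
        - 2 * Real.exp m * u * Real.sinh u - 2 * Real.exp m * Real.log 2 := by
    rw [entropyGap]; field_simp
  have hplus : Real.exp (m + u) = Real.exp m * (Real.cosh u + Real.sinh u) := by
    rw [Real.cosh_add_sinh, Real.exp_add]
  have hminus : Real.exp (m - u) = Real.exp m * (Real.cosh u - Real.sinh u) := by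
    rw [Real.cosh_sub_sinh, ← Real.exp_add, sub_eq_add_neg]
  rw [hplus, hminus]
  linarith

theorem le_logb_two_one_add {x : ℝ} (h0 : 0 ≤ x) (h1 : x ≤ 1) : x ≤ Real.logb 2 (1 + x) := by
  rw [Real.le_logb_iff_rpow_le (by norm_num) (by linarith)]
  have h := rpow_one_add_le_one_add_mul_self (s := 1) (by norm_num) h0 h1
  norm_num at h
  exact h

theorem sum_comp_neg_of_neg_mem {Y : Finset ℝ} (hneg : ∀ y ∈ Y, -y ∈ Y) (f : ℝ → ℝ) :
    ∑ y ∈ Y, f (-y) = ∑ y ∈ Y, f y :=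
  Finset.sum_nbij' (fun y => -y) (fun y => -y) hneg hneg (by simp) (by simp) (by simp)

/-- For a binary-input symmetric-output memoryless channel with finite output alphabet
`Y ⊆ ℝ` closed under negation and transition probabilities `p(y) = p(y|0) > 0` summing
to `1` (with `p(y|1) = p(-y)`), the channel capacity `C`, the Bhattacharyya rate
`B = 1 - γ`, and the cutoff rate `R₀ = 1 - log₂(1 + γ)` satisfy `C ≥ B ≥ R₀`. -/
theorem capacity_ge_bhattacharyya_rate_ge_cutoff_rate
    (Y : Finset ℝ) (p : ℝ → ℝ)
    (hneg : ∀ y ∈ Y, -y ∈ Y)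
    (hpos : ∀ y ∈ Y, 0 < p y)
    (hsum : ∑ y ∈ Y, p y = 1)
    (C γ B R₀ : ℝ)
    (hC : C = 1 - ∑ y ∈ Y, p y * Real.logb 2 ((p y + p (-y)) / p y))
    (hγ : γ = ∑ y ∈ Y, Real.sqrt (p y * p (-y)))
    (hB : B = 1 - γ)
    (hR₀ : R₀ = 1 - Real.logb 2 (1 + γ)) :
    C ≥ B ∧ B ≥ R₀ := by
  have hγ0 : 0 ≤ γ := by
    rw [hγ]
    exact Finset.sum_nonneg fun y _ => Real.sqrt_nonneg _
  have hγ1 : γ ≤ 1 := by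
    have h : 2 * γ ≤ ∑ y ∈ Y, (p y + p (-y)) := by
      rw [hγ, Finset.mul_sum]
      refine Finset.sum_le_sum fun y hy => ?_
      have ha := hpos y hy
      have hb := hpos (-y) (hneg y hy)
      rw [Real.sqrt_mul ha.le]
      nlinarith [sq_nonneg (√(p y) - √(p (-y))), Real.sq_sqrt ha.le, Real.sq_sqrt hb.le]
    rw [Finset.sum_add_distrib, sum_comp_neg_of_neg_mem hneg p, hsum] at h
    linarith
  have hent : 2 * ∑ y ∈ Y, p y * Real.logb 2 ((p y + p (-y)) / p y) ≤ 2 * γ := by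
    have hsymm := sum_comp_neg_of_neg_mem hneg
      fun y => p y * Real.logb 2 ((p y + p (-y)) / p y)
    simp only [neg_neg] at hsymm
    rw [two_mul]
    nth_rewrite 2 [← hsymm]
    rw [← Finset.sum_add_distrib, hγ, Finset.mul_sum]
    exact Finset.sum_le_sum fun y hy =>
      mul_logb_add_mul_logb_le_two_mul_sqrt (hpos y hy) (hpos (-y) (hneg y hy))
  have hcut := le_logb_two_one_add hγ0 hγ1
  constructor <;> linarith
end

section
/- For every real number a > 0, one has 2^{−a} + 2^{−1/a} ≤ 1, with equality when a = 1. -/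
/-- Secant slopes of the concave function `log` through `1`, compared at `x` and `1 - x`. -/
theorem mul_log_le_one_sub_mul_log_one_sub {x : ℝ} (hx : 0 < x) (hx' : x ≤ 1 / 2) :
    x * Real.log x ≤ (1 - x) * Real.log (1 - x) := by
  have h := strictConcaveOn_log_Ioi.concaveOn.neg.secant_mono (a := 1) (x := x) (y := 1 - x)
    (Set.mem_Ioi.2 one_pos) (Set.mem_Ioi.2 hx) (Set.mem_Ioi.2 (by linarith))
    (by linarith) (by linarith) (by linarith)
  simp only [Pi.neg_apply, Real.log_one, neg_zero, sub_zero] at h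
  rw [← neg_div_neg_eq (-Real.log x), ← neg_div_neg_eq (-Real.log (1 - x)),
    div_le_div_iff₀ (by linarith) (by linarith)] at h
  linarith

theorem monotoneOn_log_mul_log_one_sub :
    MonotoneOn (fun x : ℝ => Real.log x * Real.log (1 - x)) (Set.Ioc 0 (1 / 2)) := by
  have hd : ∀ x ∈ Set.Ioc (0 : ℝ) (1 / 2),
      HasDerivAt (fun x : ℝ => Real.log x * Real.log (1 - x))
        (x⁻¹ * Real.log (1 - x) + Real.log x * (-1 / (1 - x))) x := fun x hx =>
    (Real.hasDerivAt_log hx.1.ne').mul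
      (((hasDerivAt_id x).const_sub 1).log (by have := hx.2; simp only [id]; linarith))
  refine monotoneOn_of_deriv_nonneg (convex_Ioc _ _)
    (fun x hx => (hd x hx).continuousAt.continuousWithinAt)
    (fun x hx => (hd x (interior_subset hx)).differentiableAt.differentiableWithinAt)
    fun x hx => ?_
  have hx := interior_subset hx
  rw [(hd x hx).deriv]
  have h0 : 0 < x := hx.1
  have h1 : 0 < 1 - x := by linarith [hx.2]
  have h := mul_log_le_one_sub_mul_log_one_sub hx.1 hx.2
  have e : x⁻¹ * Real.log (1 - x) + Real.log x * (-1 / (1 - x))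
      = ((1 - x) * Real.log (1 - x) - x * Real.log x) / (x * (1 - x)) := by
    field_simp
    ring
  rw [e]
  exact div_nonneg (by linarith) (by positivity)

theorem two_rpow_neg_add_le_one_of_one_le {a : ℝ} (ha : 1 ≤ a) :
    (2 : ℝ) ^ (-a) + (2 : ℝ) ^ (-1 / a) ≤ 1 := by
  have hx0 : (0 : ℝ) < 2 ^ (-a) := by positivity
  have hx : (2 : ℝ) ^ (-a) ≤ 1 / 2 := by
    calc (2 : ℝ) ^ (-a) ≤ 2 ^ (-1 : ℝ) :=
          Real.rpow_le_rpow_of_exponent_le one_le_two (by linarith)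
      _ = 1 / 2 := by rw [Real.rpow_neg_one]; norm_num
  have h := monotoneOn_log_mul_log_one_sub ⟨hx0, hx⟩ ⟨by norm_num, le_rfl⟩ hx
  have e : Real.log (1 / 2) = -Real.log 2 := by rw [one_div, Real.log_inv]
  have e' : (1 - 1 / 2 : ℝ) = 1 / 2 := by norm_num
  simp only [e', e, Real.log_rpow two_pos] at h
  have hc : 0 < Real.log 2 := Real.log_pos one_lt_two
  have h' : -Real.log 2 ≤ Real.log (1 - 2 ^ (-a)) * a := by
    refine le_of_mul_le_mul_left ?_ hc
    linarith
  have hle : (2 : ℝ) ^ (-1 / a) ≤ 1 - 2 ^ (-a) := by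
    rw [Real.rpow_le_iff_le_log two_pos (by linarith), div_mul_eq_mul_div,
      div_le_iff₀ (by linarith)]
    linarith
  linarith

/-- For every real `a > 0`, one has `2^(-a) + 2^(-1/a) ≤ 1`, with equality when `a = 1`. -/
theorem two_rpow_neg_add_le_one (a : ℝ) (ha : 0 < a) :
    (2 : ℝ) ^ (-a) + (2 : ℝ) ^ (-1 / a) ≤ 1 ∧
      (a = 1 → (2 : ℝ) ^ (-a) + (2 : ℝ) ^ (-1 / a) = 1) := by
  refine ⟨?_, ?_⟩
  · rcases le_total 1 a with h | h
    · exact two_rpow_neg_add_le_one_of_one_le h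
    · have := two_rpow_neg_add_le_one_of_one_le ((one_le_inv₀ ha).2 h)
      rwa [div_inv_eq_mul, neg_one_mul, add_comm, inv_eq_one_div, ← neg_div] at this
  · rintro rfl
    rw [div_one, Real.rpow_neg_one]
    norm_num
end

section
/- Fix an integer Q ≥ 1 and a real c with 0 < c < 1. For each m ∈ {1,…,Q}, let (μ_m^{λ})_{λ>0} be a family of Borel probability measures on ℝ, each supported on the interval (0,1], such that for every c′ with 0 < c′ < 1, lim_{λ→∞} λ·μ_m^{λ}({x : x > c′}) = −ln c′. Let τ_1,…,τ_Q be positive reals with τ_m > 1 − c for every m and ∑_{m=1}^{Q} τ_m = 1. Then, taking the product measure μ_1^{λ_1} ⊗ ⋯ ⊗ μ_Q^{λ_Q} (i.e., φ_1,…,φ_Q independent with φ_m distributed as μ_m^{λ_m}), limsup over (λ_1,…,λ_Q) → (∞,…,∞) (along the product of the at-top filters) of (∏_{m=1}^{Q} λ_m) · P[∑_{m=1}^{Q} τ_m φ_m > c] ≤ (1/Q!)·∏_{m=1}^{Q} ln( τ_m / (c − (1 − τ_m)) ). -/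
open MeasureTheory Filter

/-- If `∑ y ≥ 1`, the convex function `y ↦ ∑ τ m * exp (-(L m * y m))`, equal to `c` at the unit
vectors, is at most `c` at `y`. -/
lemma sum_mul_exp_le_of_one_le_sum {ι : Type*} [Fintype ι] {c : ℝ} {τ L y : ι → ℝ}
    (hτ : ∀ m, 0 < τ m) (hτsum : ∑ m, τ m = 1) (hL : ∀ m, 0 < L m)
    (hvertex : ∀ m, τ m * Real.exp (-L m) = c - (1 - τ m))
    (hy : ∀ m, 0 ≤ y m) (hsum : 1 ≤ ∑ m, y m) :
    ∑ m, τ m * Real.exp (-(L m * y m)) ≤ c := by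
  set Y := ∑ m, y m with hY
  have hYpos : 0 < Y := by linarith
  have key : ∀ m, τ m * Real.exp (-(L m * y m)) ≤ τ m - (y m / Y) * (1 - c) := by
    intro m
    have ht0 : 0 ≤ y m / Y := div_nonneg (hy m) hYpos.le
    have ht1 : y m / Y ≤ 1 := by
      rw [div_le_one hYpos]
      exact Finset.single_le_sum (fun i _ => hy i) (Finset.mem_univ m)
    have hty : y m / Y ≤ y m := div_le_self (hy m) hsum
    have hmono : Real.exp (-(L m * y m)) ≤ Real.exp (y m / Y * (-L m)) := by
      apply Real.exp_le_exp.2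
      nlinarith [hL m]
    have hconv := convexOn_exp.2 (Set.mem_univ 0) (Set.mem_univ (-L m))
      (sub_nonneg.2 ht1) ht0 (by ring)
    simp only [smul_eq_mul, mul_zero, zero_add, Real.exp_zero, mul_one] at hconv
    have h := mul_le_mul_of_nonneg_left (hmono.trans hconv) (hτ m).le
    have hv := hvertex m
    calc _ ≤ _ := h
      _ = τ m - (y m / Y) * (τ m - τ m * Real.exp (-L m)) := by ring
      _ = _ := by rw [hv]; ring
  calc _ ≤ ∑ m, (τ m - (y m / Y) * (1 - c)) := Finset.sum_le_sum fun m _ => key m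
    _ = c := by
      rw [Finset.sum_sub_distrib, ← Finset.sum_mul, ← Finset.sum_div, hτsum, ← hY,
        div_self hYpos.ne']
      ring

/-- The values `x` for which `-log x / L` lies in `[j / (n + 1), (j + 1) / (n + 1))`. -/
def expCell (L : ℝ) (n j : ℕ) : Set ℝ :=
  Set.Ioc (Real.exp (-(L * ((j + 1) / (n + 1))))) (Real.exp (-(L * (j / (n + 1)))))

lemma mem_expCell_floor {L x : ℝ} (hL : 0 < L) (hx : x ∈ Set.Ioc (0 : ℝ) 1) (n : ℕ) :
    x ∈ expCell L n ⌊(n + 1) * (-Real.log x / L)⌋₊ := by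
  have hlog : Real.log x ≤ 0 := Real.log_nonpos hx.1.le hx.2
  have hy : 0 ≤ -Real.log x / L := div_nonneg (by linarith) hL.le
  have hn : (0 : ℝ) < n + 1 := by positivity
  have hexp : x = Real.exp (-(L * (-Real.log x / L))) := by
    rw [mul_div_cancel₀ _ hL.ne', neg_neg, Real.exp_log hx.1]
  generalize -Real.log x / L = y at *
  rw [hexp, expCell]
  constructor
  · apply Real.exp_lt_exp.2
    apply neg_lt_neg
    apply mul_lt_mul_of_pos_left _ hL
    rw [lt_div_iff₀ hn, mul_comm]
    exact Nat.lt_floor_add_one _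
  · apply Real.exp_le_exp.2
    apply neg_le_neg
    apply mul_le_mul_of_nonneg_left _ hL.le
    rw [div_le_iff₀ hn, mul_comm]
    exact Nat.floor_le (by positivity)

lemma tendsto_mul_measure_expCell {μ : ℝ → Measure ℝ}
    (hprob : ∀ l : ℝ, 0 < l → IsProbabilityMeasure (μ l))
    (hsupp : ∀ l : ℝ, 0 < l → μ l (Set.Ioc (0 : ℝ) 1)ᶜ = 0)
    (htail : ∀ c' : ℝ, 0 < c' → c' < 1 →
      Tendsto (fun l : ℝ => l * (μ l {x : ℝ | c' < x}).toReal) atTop (nhds (-Real.log c')))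
    {L : ℝ} (hL : 0 < L) (n j : ℕ) :
    Tendsto (fun l : ℝ => l * (μ l (expCell L n j)).toReal) atTop (nhds (L / (n + 1))) := by
  have htail' : ∀ t : ℝ, 0 ≤ t →
      Tendsto (fun l : ℝ => l * (μ l (Set.Ioi (Real.exp (-t)))).toReal) atTop (nhds t) := by
    intro t ht
    rcases ht.eq_or_lt with rfl | ht
    · refine tendsto_const_nhds.congr' ?_
      filter_upwards [eventually_gt_atTop 0] with l hl
      have : μ l (Set.Ioi (Real.exp (-0))) = 0 := by
        refine measure_mono_null ?_ (hsupp l hl)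
        intro x hx hx'
        simp only [neg_zero, Real.exp_zero, Set.mem_Ioi] at hx
        exact absurd hx'.2 (not_le.2 hx)
      rw [this, ENNReal.toReal_zero, mul_zero]
    · have h := htail (Real.exp (-t)) (Real.exp_pos _) (by simpa using ht)
      rwa [Real.log_exp, neg_neg] at h
  have hlt : L * (j / (n + 1)) ≤ L * ((j + 1) / (n + 1)) := by gcongr; linarith
  have h := (htail' (L * ((j + 1) / (n + 1))) (by positivity)).sub
    (htail' (L * (j / (n + 1))) (by positivity))
  have hval : L * ((j + 1) / (n + 1)) - L * (j / (n + 1)) = L / ((n : ℝ) + 1) := by ring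
  rw [hval] at h
  refine h.congr' ?_
  filter_upwards [eventually_gt_atTop 0] with l hl
  have := hprob l hl
  rw [← mul_sub, expCell, ← Set.Ioi_sdiff_Ioi]
  congr 1
  exact (measureReal_sdiff (Set.Ioi_subset_Ioi (Real.exp_le_exp.2 (neg_le_neg hlt)))
    measurableSet_Ioi).symm

lemma measure_pi_le_sum_expCell {Q : ℕ} {c : ℝ} {τ L : Fin Q → ℝ}
    (hτ : ∀ m, 0 < τ m) (hτsum : ∑ m, τ m = 1) (hL : ∀ m, 0 < L m)
    (hvertex : ∀ m, τ m * Real.exp (-L m) = c - (1 - τ m))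
    (ν : Fin Q → Measure ℝ) [∀ m, IsProbabilityMeasure (ν m)]
    (hsupp : ∀ m, ν m (Set.Ioc (0 : ℝ) 1)ᶜ = 0) (n : ℕ) :
    ((Measure.pi ν) {φ : Fin Q → ℝ | c < ∑ m, τ m * φ m}).toReal ≤
      ∑ k ∈ (Finset.univ : Finset (Fin (Q + 1))).finsuppAntidiag n,
        ∏ m : Fin Q, (ν m (expCell (L m) n (k m.succ))).toReal := by
  set S := (Finset.univ : Finset (Fin (Q + 1))).finsuppAntidiag n with hS
  have hae : ∀ᵐ φ ∂Measure.pi ν, ∀ m, φ m ∈ Set.Ioc (0 : ℝ) 1 :=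
    eventually_all.2 fun m => Measure.tendsto_eval_ae_ae.eventually (mem_ae_iff.2 (hsupp m))
  have hcover : {φ : Fin Q → ℝ | c < ∑ m, τ m * φ m} ≤ᵐ[Measure.pi ν]
      ⋃ k ∈ S, Set.pi Set.univ fun m => expCell (L m) n (k m.succ) := by
    filter_upwards [hae] with φ hφ hc
    set y : Fin Q → ℝ := fun m => -Real.log (φ m) / L m with hy
    have hy0 : ∀ m, 0 ≤ y m := fun m =>
      div_nonneg (neg_nonneg.2 (Real.log_nonpos (hφ m).1.le (hφ m).2)) (hL m).le
    have hsum : ∑ m, y m < 1 := by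
      by_contra! h
      have hle := sum_mul_exp_le_of_one_le_sum hτ hτsum hL hvertex hy0 h
      have heq : ∀ m, Real.exp (-(L m * y m)) = φ m := fun m => by
        rw [hy]
        simp only
        rw [mul_div_cancel₀ _ (hL m).ne', neg_neg, Real.exp_log (hφ m).1]
      simp only [heq] at hle
      exact absurd hc (not_lt.2 hle)
    have hfloor : ∑ m, ⌊((n : ℝ) + 1) * y m⌋₊ ≤ n := by
      have hn : (0 : ℝ) < n + 1 := by positivity
      rw [← Nat.lt_succ_iff, ← Nat.cast_lt (α := ℝ)]
      push_cast
      calc _ ≤ ∑ m, ((n : ℝ) + 1) * y m :=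
            Finset.sum_le_sum fun m _ => Nat.floor_le (mul_nonneg hn.le (hy0 m))
        _ = (n + 1) * ∑ m, y m := by rw [Finset.mul_sum]
        _ < n + 1 := by nlinarith
    refine Set.mem_iUnion₂.2 ⟨Finsupp.equivFunOnFinite.symm
      (Fin.cons (n - ∑ m, ⌊((n : ℝ) + 1) * y m⌋₊) fun m => ⌊((n : ℝ) + 1) * y m⌋₊), ?_, ?_⟩
    · rw [hS, Finset.mem_finsuppAntidiag]
      refine ⟨?_, Finset.subset_univ _⟩
      rw [Fin.sum_univ_succ]
      simp only [Finsupp.coe_equivFunOnFinite_symm, Fin.cons_zero, Fin.cons_succ]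
      omega
    · intro m _
      simpa using mem_expCell_floor (hL m) (hφ m) n
  calc _ ≤ (Measure.pi ν).real (⋃ k ∈ S, Set.pi Set.univ fun m => expCell (L m) n (k m.succ)) :=
        ENNReal.toReal_mono (measure_ne_top _ _) (measure_mono_ae hcover)
    _ ≤ ∑ k ∈ S, (Measure.pi ν).real (Set.pi Set.univ fun m => expCell (L m) n (k m.succ)) :=
        measureReal_biUnion_finset_le _ _
    _ = _ := by simp [Measure.real, Measure.pi_pi, ENNReal.toReal_prod]

lemma card_finsuppAntidiag_fin_succ_le (Q n : ℕ) :
    (((Finset.univ : Finset (Fin (Q + 1))).finsuppAntidiag n).card : ℝ) ≤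
      1 / (Nat.factorial Q : ℝ) * ((n : ℝ) + Q) ^ Q := by
  rw [Finset.card_finsuppAntidiag_nat_eq_choose, Finset.card_univ, Fintype.card_fin]
  have h := Nat.ascFactorial_le_pow_add n Q
  rw [Nat.ascFactorial_eq_factorial_mul_choose] at h
  have hc : (Q + 1 + n - 1).choose n = (n + Q).choose Q := by
    rw [show Q + 1 + n - 1 = n + Q by omega, Nat.choose_symm_add]
  rw [hc, one_div, ← div_eq_inv_mul, le_div_iff₀ (by positivity), mul_comm]
  exact_mod_cast h

/-- Asymptotic outage bound (Theorem 3 of the paper): given `Q ≥ 1`, `0 < c < 1`,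
families `μ m λ` of Borel probability measures on `ℝ` supported on `(0,1]` with the
tail behavior `lim_{λ→∞} λ·μ m λ {x > c'} = -ln c'` for every `0 < c' < 1`, and
positive weights `τ m > 1 - c` summing to `1`, the limsup along the product at-top
filter of `(∏ m, λ m)·P[∑ m, τ m·φ m > c]` (with `φ₁,…,φ_Q` independent, `φ m ∼ μ m (λ m)`)
is at most `(1/Q!)·∏ m, ln(τ m/(c - (1 - τ m)))`. -/
theorem asymptotic_outage_bound (Q : ℕ) (hQ : 1 ≤ Q) (c : ℝ) (hc0 : 0 < c) (hc1 : c < 1)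
    (μ : Fin Q → ℝ → Measure ℝ)
    (hprob : ∀ m (l : ℝ), 0 < l → IsProbabilityMeasure (μ m l))
    (hsupp : ∀ m (l : ℝ), 0 < l → μ m l (Set.Ioc (0 : ℝ) 1)ᶜ = 0)
    (htail : ∀ m (c' : ℝ), 0 < c' → c' < 1 →
      Tendsto (fun l : ℝ => l * (μ m l {x : ℝ | c' < x}).toReal)
        atTop (nhds (-Real.log c')))
    (τ : Fin Q → ℝ) (hτpos : ∀ m, 0 < τ m) (hτ : ∀ m, 1 - c < τ m)
    (hτsum : ∑ m, τ m = 1) :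
    Filter.limsup
      (fun l : Fin Q → ℝ => (∏ m, l m) *
        ((Measure.pi fun m => μ m (l m))
          {φ : Fin Q → ℝ | c < ∑ m, τ m * φ m}).toReal)
      (Filter.pi fun _ : Fin Q => (atTop : Filter ℝ))
      ≤ (1 / (Nat.factorial Q : ℝ)) * ∏ m, Real.log (τ m / (c - (1 - τ m))) := by
  set L : Fin Q → ℝ := fun m => Real.log (τ m / (c - (1 - τ m))) with hLdef
  have hden : ∀ m, 0 < c - (1 - τ m) := fun m => by linarith [hτ m]
  have hL : ∀ m, 0 < L m := fun m =>
    Real.log_pos ((one_lt_div (hden m)).2 (by linarith))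
  have hvertex : ∀ m, τ m * Real.exp (-L m) = c - (1 - τ m) := fun m => by
    have := (hden m).ne'
    have := (hτpos m).ne'
    rw [Real.exp_neg, Real.exp_log (div_pos (hτpos m) (hden m))]
    field_simp
  have hpos : ∀ᶠ l : Fin Q → ℝ in Filter.pi fun _ : Fin Q => (atTop : Filter ℝ), ∀ m, 0 < l m :=
    eventually_all.2 fun m => (tendsto_eval_pi _ m).eventually (eventually_gt_atTop 0)
  have hbound : ∀ n : ℕ, Filter.limsup
      (fun l : Fin Q → ℝ => (∏ m, l m) *
        ((Measure.pi fun m => μ m (l m)) {φ : Fin Q → ℝ | c < ∑ m, τ m * φ m}).toReal)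
      (Filter.pi fun _ : Fin Q => (atTop : Filter ℝ)) ≤
        1 / (Nat.factorial Q : ℝ) * (∏ m, L m) * (((n : ℝ) + Q) / (n + 1)) ^ Q := by
    intro n
    have hlim : Tendsto (fun l : Fin Q → ℝ =>
        ∑ k ∈ (Finset.univ : Finset (Fin (Q + 1))).finsuppAntidiag n,
          ∏ m : Fin Q, (l m * (μ m (l m) (expCell (L m) n (k m.succ))).toReal))
        (Filter.pi fun _ : Fin Q => (atTop : Filter ℝ))
        (nhds (∑ k ∈ (Finset.univ : Finset (Fin (Q + 1))).finsuppAntidiag n,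
          ∏ m : Fin Q, L m / ((n : ℝ) + 1))) :=
      tendsto_finsetSum _ fun k _ => tendsto_finsetProd _ fun m _ =>
        (tendsto_mul_measure_expCell (hprob m) (hsupp m) (htail m) (hL m) n (k m.succ)).comp
          (tendsto_eval_pi _ m)
    have hcob := isCoboundedUnder_le_of_eventually_le
      (Filter.pi fun _ : Fin Q => (atTop : Filter ℝ)) (x := 0)
      (f := fun l : Fin Q → ℝ => (∏ m, l m) *
        ((Measure.pi fun m => μ m (l m)) {φ : Fin Q → ℝ | c < ∑ m, τ m * φ m}).toReal) <| by
      filter_upwards [hpos] with l hl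
      exact mul_nonneg (Finset.prod_nonneg fun m _ => (hl m).le) ENNReal.toReal_nonneg
    refine (limsup_le_limsup ?_ hcob hlim.isBoundedUnder_le).trans ?_
    · filter_upwards [hpos] with l hl
      have : ∀ m, IsProbabilityMeasure (μ m (l m)) := fun m => hprob m _ (hl m)
      simp only [Finset.prod_mul_distrib, ← Finset.mul_sum]
      exact mul_le_mul_of_nonneg_left
        (measure_pi_le_sum_expCell hτpos hτsum hL hvertex (fun m => μ m (l m))
          (fun m => hsupp m _ (hl m)) n)
        (Finset.prod_nonneg fun m _ => (hl m).le)
    · rw [hlim.limsup_eq, Finset.sum_const, nsmul_eq_mul, Finset.prod_div_distrib,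
        Finset.prod_const, Finset.card_univ, Fintype.card_fin]
      have hP : 0 ≤ (∏ m, L m) / ((n : ℝ) + 1) ^ Q :=
        div_nonneg (Finset.prod_nonneg fun m _ => (hL m).le) (by positivity)
      calc _ ≤ _ := mul_le_mul_of_nonneg_right (card_finsuppAntidiag_fin_succ_le Q n) hP
        _ = _ := by rw [div_pow]; ring
  have hratio : Tendsto (fun n : ℕ => ((n : ℝ) + Q) / (n + 1)) atTop (nhds 1) := by
    have h := (tendsto_one_div_add_atTop_nhds_zero_nat (𝕜 := ℝ)).const_mul ((Q : ℝ) - 1)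
    have h' := h.const_add 1
    rw [mul_zero, add_zero] at h'
    refine h'.congr fun n => ?_
    have : (n : ℝ) + 1 ≠ 0 := by positivity
    field_simp
    ring
  have hfinal := (hratio.pow Q).const_mul (1 / (Nat.factorial Q : ℝ) * ∏ m, L m)
  rw [one_pow, mul_one] at hfinal
  exact ge_of_tendsto' hfinal hbound
end

section
/- Fix an integer M ≥ 1, a real c★ > 0, positive reals d_0,…,d_{M−1}, and L > 0. Let τ_0,…,τ_{M−1} be positive reals with ∑_{i=0}^{M−1} τ_i = 1 and τ_i > 1 − e^{−c★} for every i, and define χ(τ) = ln( τ / (e^{−c★} − (1−τ)) ). Let ν_0,…,ν_{M−1} be independent exponentially distributed random variables with mean 1. Then limsup_{E→∞} E^M · P[ ∑_{i=0}^{M−1} τ_i·exp(−ν_i·E·d_i^{−L}) ≥ e^{−c★} ] ≤ (1/M!)·∏_{i=0}^{M−1} χ(τ_i)·d_i^{L}. -/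
open MeasureTheory Filter ProbabilityTheory

/-- The exponential measure of rate one is dominated by Lebesgue measure. -/
lemma expMeasure_one_le_volume : expMeasure 1 ≤ (volume : Measure ℝ) := by
  have h : (volume : Measure ℝ).withDensity (exponentialPDF 1) ≤ volume.withDensity 1 := by
    refine withDensity_mono (Eventually.of_forall fun x => ?_)
    rw [exponentialPDF_eq, Pi.one_apply]
    refine ENNReal.ofReal_le_one.2 ?_
    split_ifs with hx
    · simpa using hx
    · exact zero_le_one
  rwa [withDensity_one] at h

lemma expMeasure_one_ae_nonneg : ∀ᵐ x ∂(expMeasure 1), 0 ≤ x := by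
  rw [ae_iff]
  simp only [not_le]
  change (volume.withDensity (exponentialPDF 1)) (Set.Iio 0) = 0
  rw [withDensity_apply _ measurableSet_Iio]
  exact lintegral_exponentialPDF_of_nonpos le_rfl

/-- A product of measures dominated by Lebesgue measure gives a corner simplex at most its
Lebesgue volume. -/
lemma pi_simplex_le (μ : Measure ℝ) [SigmaFinite μ] (hμ : μ ≤ volume) (n : ℕ) (b : Fin n → ℝ)
    (hb : ∀ i, 0 < b i) (t : ℝ) (ht : 0 ≤ t) :
    (Measure.pi fun _ : Fin n => μ) {x | (∀ i, 0 ≤ x i) ∧ ∑ i, x i * b i ≤ t}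
      ≤ ENNReal.ofReal (t ^ n / (n.factorial * ∏ i, b i)) := by
  induction n generalizing t with
  | zero => simp [ht]
  | succ n ih =>
    set A : Set (ℝ × (Fin n → ℝ)) :=
      {p | 0 ≤ p.1 ∧ (∀ i, 0 ≤ p.2 i) ∧ p.1 * b 0 + ∑ i, p.2 i * b i.succ ≤ t} with hA
    have hAm : MeasurableSet A := by
      refine (measurableSet_le measurable_const measurable_fst).inter
        (MeasurableSet.inter ?_ (measurableSet_le (f := fun p : ℝ × (Fin n → ℝ) =>
          p.1 * b 0 + ∑ i, p.2 i * b i.succ) (by fun_prop) measurable_const))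
      change MeasurableSet {p : ℝ × (Fin n → ℝ) | ∀ i, 0 ≤ p.2 i}
      rw [Set.ofPred_forall]
      exact MeasurableSet.iInter fun i => measurableSet_le measurable_const (by fun_prop)
    have hpre := measurePreserving_piFinSuccAbove (fun _ : Fin (n + 1) => μ) 0
    have hset : {x : Fin (n + 1) → ℝ | (∀ i, 0 ≤ x i) ∧ ∑ i, x i * b i ≤ t}
        = (MeasurableEquiv.piFinSuccAbove (fun _ : Fin (n + 1) => ℝ) 0) ⁻¹' A := by
      ext x
      simp [hA, Fin.forall_fin_succ, Fin.sum_univ_succ, MeasurableEquiv.piFinSuccAbove,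
        Fin.insertNthEquiv, Fin.tail, and_assoc]
    rw [hset, hpre.measure_preimage hAm.nullMeasurableSet, Measure.prod_apply hAm]
    have hb0 := hb 0
    set C : ℝ := n.factorial * ∏ i : Fin n, b i.succ with hC
    have hCpos : 0 < C := mul_pos (by positivity) (Finset.prod_pos fun i _ => hb i.succ)
    have hslice : ∀ y : ℝ, (Measure.pi fun _ : Fin n => μ) (Prod.mk y ⁻¹' A)
        ≤ (Set.Icc 0 (t / b 0)).indicator
          (fun y => ENNReal.ofReal ((t - y * b 0) ^ n / C)) y := by
      intro y
      by_cases hy : y ∈ Set.Icc 0 (t / b 0)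
      · rw [Set.indicator_of_mem hy]
        have hty : 0 ≤ t - y * b 0 := by
          have := (le_div_iff₀ hb0).1 hy.2
          linarith
        refine (measure_mono fun z hz => ?_).trans
          (ih (fun i => b i.succ) (fun i => hb i.succ) (t - y * b 0) hty)
        exact ⟨hz.2.1, by linarith [hz.2.2]⟩
      · rw [Set.indicator_of_notMem hy]
        have hempty : Prod.mk y ⁻¹' A = ∅ := by
          refine Set.eq_empty_of_forall_notMem fun z hz => hy ⟨hz.1, ?_⟩
          rw [le_div_iff₀ hb0]
          have hz2 : y * b 0 + ∑ i, z i * b i.succ ≤ t := hz.2.2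
          have : 0 ≤ ∑ i, z i * b i.succ :=
            Finset.sum_nonneg fun i _ => mul_nonneg (hz.2.1 i) (hb i.succ).le
          linarith
        simp [hempty]
    have htb : 0 ≤ t / b 0 := div_nonneg ht hb0.le
    have hint : ∫ y in (0 : ℝ)..(t / b 0), (t - y * b 0) ^ n / C
        = t ^ (n + 1) / ((n + 1).factorial * ∏ i, b i) := by
      have hderiv : ∀ y ∈ Set.uIcc 0 (t / b 0),
          HasDerivAt (fun y => -((t - y * b 0) ^ (n + 1) / ((n + 1) * b 0 * C)))
            ((t - y * b 0) ^ n / C) y := by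
        intro y _
        have h := (((((hasDerivAt_id y).mul_const (b 0)).const_sub t).pow (n + 1)).div_const
          ((n + 1) * b 0 * C)).neg
        refine h.congr_deriv ?_
        simp only [id, Nat.cast_add, Nat.cast_one, Nat.add_sub_cancel]
        field_simp
      rw [intervalIntegral.integral_eq_sub_of_hasDerivAt hderiv
        (Continuous.intervalIntegrable (by fun_prop) _ _), div_mul_cancel₀ _ hb0.ne',
        Fin.prod_univ_succ, Nat.factorial_succ, hC]
      push_cast
      simp only [sub_self, zero_mul, sub_zero, ne_eq, Nat.add_eq_zero_iff, one_ne_zero, and_false,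
        not_false_eq_true, zero_pow, zero_div, neg_zero, zero_sub, neg_neg]
      congr 1
      ring
    calc ∫⁻ y, (Measure.pi fun _ : Fin n => μ) (Prod.mk y ⁻¹' A) ∂μ
        ≤ ∫⁻ y, (Set.Icc 0 (t / b 0)).indicator
          (fun y => ENNReal.ofReal ((t - y * b 0) ^ n / C)) y := lintegral_mono' hμ hslice
      _ = ∫⁻ y in Set.Icc 0 (t / b 0), ENNReal.ofReal ((t - y * b 0) ^ n / C) :=
        lintegral_indicator measurableSet_Icc _
      _ = ENNReal.ofReal (∫ y in Set.Icc 0 (t / b 0), (t - y * b 0) ^ n / C) := by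
        refine (ofReal_integral_eq_lintegral_ofReal
          (Continuous.integrableOn_Icc (by fun_prop)) ?_).symm
        filter_upwards [ae_restrict_mem measurableSet_Icc] with y hy
        have := (le_div_iff₀ hb0).1 hy.2
        exact div_nonneg (pow_nonneg (by linarith) _) hCpos.le
      _ = ENNReal.ofReal (t ^ (n + 1) / ((n + 1).factorial * ∏ i, b i)) := by
        rw [integral_Icc_eq_integral_Ioc, ← intervalIntegral.integral_of_le htb, hint]

/-- By convexity of the exponential, a nonnegative point at which `∑ τ i * exp (-x i) ≥ c` lies in
the corner simplex cut out by the axis intercepts `a i` of the level set. -/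
lemma sum_div_le_one_of_le_sum_mul_exp_neg {ι : Type*} [Fintype ι] {τ a x : ι → ℝ} {c : ℝ}
    (hτ : ∀ i, 0 < τ i) (hsum : ∑ i, τ i = 1) (ha : ∀ i, 0 < a i)
    (hac : ∀ i, τ i * Real.exp (-a i) = c - (1 - τ i)) (hx : ∀ i, 0 ≤ x i)
    (h : c ≤ ∑ i, τ i * Real.exp (-x i)) : ∑ i, x i / a i ≤ 1 := by
  by_contra! hS
  set S := ∑ i, x i / a i with hSdef
  have hS0 : 0 < S := one_pos.trans hS
  set w : ι → ℝ := fun i => x i / a i / S with hw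
  have hw0 : ∀ i, 0 ≤ w i := fun i => div_nonneg (div_nonneg (hx i) (ha i).le) hS0.le
  have hwsum : ∑ i, w i = 1 := by
    rw [hw, ← Finset.sum_div, ← hSdef, div_self hS0.ne']
  have hw1 : ∀ i, w i ≤ 1 := fun i =>
    hwsum ▸ Finset.single_le_sum (fun j _ => hw0 j) (Finset.mem_univ i)
  have hexp : ∀ i, Real.exp (-(S * a i)) < Real.exp (-a i) := fun i =>
    Real.exp_lt_exp.2 (by nlinarith [ha i])
  have hconv : ∀ i, τ i * Real.exp (-x i) ≤ τ i - w i * (τ i * (1 - Real.exp (-(S * a i)))) := by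
    intro i
    have hcx := convexOn_exp.2 (Set.mem_univ (-(S * a i))) (Set.mem_univ 0) (hw0 i)
      (sub_nonneg.2 (hw1 i)) (by ring)
    have hxi : w i * (S * a i) = x i := by
      have := (ha i).ne'
      simp only [hw]
      field_simp
    simp only [smul_eq_mul, mul_zero, add_zero, mul_neg, hxi, Real.exp_zero, mul_one] at hcx
    nlinarith [mul_le_mul_of_nonneg_left hcx (hτ i).le]
  have hle : ∀ i, w i * (1 - c) ≤ w i * (τ i * (1 - Real.exp (-(S * a i)))) := fun i =>
    mul_le_mul_of_nonneg_left
      (by nlinarith [hac i, mul_lt_mul_of_pos_left (hexp i) (hτ i)]) (hw0 i)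
  obtain ⟨j, -, hj⟩ : ∃ j ∈ Finset.univ, 0 < w j :=
    Finset.exists_lt_of_sum_lt (by simp [hwsum])
  have hlt : ∑ i, w i * (1 - c) < ∑ i, w i * (τ i * (1 - Real.exp (-(S * a i)))) :=
    Finset.sum_lt_sum (fun i _ => hle i) ⟨j, Finset.mem_univ j, mul_lt_mul_of_pos_left
      (by nlinarith [hac j, mul_lt_mul_of_pos_left (hexp j) (hτ j)]) hj⟩
  have htot := Finset.sum_le_sum fun i (_ : i ∈ Finset.univ) => hconv i
  rw [Finset.sum_sub_distrib, hsum] at htot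
  rw [← Finset.sum_mul, hwsum] at hlt
  linarith

/-- Transmitter-clustering asymptotic code-outage bound: with `M ≥ 1`, code threshold
`c★ > 0`, distances `d_i > 0`, path-loss exponent `L > 0`, assignment rates `τ_i > 1 - e^{-c★}`
summing to `1`, and i.i.d. mean-1 exponential channel powers `ν_i`,
`limsup_{E→∞} E^M · P[∑ τ_i·exp(-ν_i·E·d_i^{-L}) ≥ e^{-c★}]
  ≤ (1/M!)·∏ χ(τ_i)·d_i^L`, where `χ(τ) = ln(τ/(e^{-c★} - (1-τ)))`. -/
theorem transmitter_clustering_outage_limsup (M : ℕ) (hM : 1 ≤ M)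
    (cstar : ℝ) (hcstar : 0 < cstar)
    (d : Fin M → ℝ) (hd : ∀ i, 0 < d i) (L : ℝ) (hL : 0 < L)
    (τ : Fin M → ℝ) (hτpos : ∀ i, 0 < τ i) (hτsum : ∑ i, τ i = 1)
    (hτ : ∀ i, 1 - Real.exp (-cstar) < τ i)
    (χ : ℝ → ℝ) (hχ : ∀ t, χ t = Real.log (t / (Real.exp (-cstar) - (1 - t)))) :
    Filter.limsup
      (fun E : ℝ => E ^ M *
        ((Measure.pi fun _ : Fin M => expMeasure 1)
          {ν : Fin M → ℝ |
            Real.exp (-cstar) ≤ ∑ i, τ i * Real.exp (-(ν i * (E * d i ^ (-L))))}).toReal)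
      atTop
      ≤ (1 / (Nat.factorial M : ℝ)) * ∏ i, χ (τ i) * d i ^ L := by
  set c := Real.exp (-cstar) with hc
  have hc1 : c < 1 := by rw [hc, Real.exp_lt_one_iff]; linarith
  have hden : ∀ i, 0 < c - (1 - τ i) := fun i => by linarith [hτ i]
  have hχpos : ∀ i, 0 < χ (τ i) := fun i => by
    rw [hχ]
    exact Real.log_pos ((one_lt_div (hden i)).2 (by linarith))
  have hχexp : ∀ i, τ i * Real.exp (-χ (τ i)) = c - (1 - τ i) := fun i => by
    rw [hχ, Real.exp_neg, Real.exp_log (div_pos (hτpos i) (hden i)), inv_div,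
      mul_div_cancel₀ _ (hτpos i).ne']
  have : IsProbabilityMeasure (expMeasure 1) := isProbabilityMeasure_expMeasure one_pos
  refine limsup_le_of_le (isCoboundedUnder_le_of_eventually_le atTop (x := 0) ?_) ?_
  · filter_upwards [eventually_ge_atTop 0] with E hE
    positivity
  filter_upwards [eventually_gt_atTop 0] with E hE
  set b : Fin M → ℝ := fun i => E * d i ^ (-L) / χ (τ i) with hb
  have hsnr : ∀ i, 0 < E * d i ^ (-L) := fun i => mul_pos hE (Real.rpow_pos_of_pos (hd i) _)
  have hbpos : ∀ i, 0 < b i := fun i => div_pos (hsnr i) (hχpos i)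
  have hnonneg : ∀ᵐ ν ∂(Measure.pi fun _ : Fin M => expMeasure 1), ∀ i, 0 ≤ ν i :=
    ae_all_iff.2 fun i =>
      (Measure.quasiMeasurePreserving_eval _ i).ae expMeasure_one_ae_nonneg
  have hmeas : (Measure.pi fun _ : Fin M => expMeasure 1)
      {ν : Fin M → ℝ | c ≤ ∑ i, τ i * Real.exp (-(ν i * (E * d i ^ (-L))))}
      ≤ ENNReal.ofReal (1 ^ M / (M.factorial * ∏ i, b i)) := by
    refine (measure_mono_ae ?_).trans
      (pi_simplex_le _ expMeasure_one_le_volume M b hbpos 1 zero_le_one)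
    filter_upwards [hnonneg] with ν hν hmem
    refine ⟨hν, ?_⟩
    have := sum_div_le_one_of_le_sum_mul_exp_neg hτpos hτsum hχpos hχexp
      (fun i => mul_nonneg (hν i) (hsnr i).le) hmem
    simpa only [hb, mul_div_assoc] using this
  have hprod : 0 < ∏ i, b i := Finset.prod_pos fun i _ => hbpos i
  have hreal := ENNReal.toReal_mono ENNReal.ofReal_ne_top hmeas
  rw [ENNReal.toReal_ofReal (by positivity)] at hreal
  refine (mul_le_mul_of_nonneg_left hreal (by positivity)).trans_eq ?_
  have hEprod : (∏ i, b i) * ∏ i, χ (τ i) * d i ^ L = E ^ M := by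
    rw [← Finset.prod_mul_distrib]
    trans ∏ _i : Fin M, E
    · refine Finset.prod_congr rfl fun i _ => ?_
      have h1 := (hχpos i).ne'
      have h2 := (Real.rpow_pos_of_pos (hd i) L).ne'
      simp only [hb, Real.rpow_neg (hd i).le]
      field_simp
    · simp
  rw [← hEprod, one_pow]
  have h1 := hprod.ne'
  field_simp
end

section
/- Let q be a real number with 0 < q < 1 and let j ≥ 1 be an integer. Then ∫_q^1 (1/z)·((z − q)/(1 − q))^{j−1} dz ≤ (−ln q)/j. -/
/-- Chebyshev's integral inequality for continuous functions that vary oppositely. -/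
theorem AntivaryOn.sub_mul_intervalIntegral_mul_le {f g : ℝ → ℝ} {a b : ℝ} (hab : a < b)
    (hfg : AntivaryOn f g (Set.Icc a b)) (hf : ContinuousOn f (Set.Icc a b))
    (hg : ContinuousOn g (Set.Icc a b)) :
    (b - a) * ∫ x in a..b, f x * g x ≤ (∫ x in a..b, f x) * ∫ x in a..b, g x := by
  have hu : Set.uIcc a b = Set.Icc a b := Set.uIcc_of_le hab.le
  have hf' : IntervalIntegrable f MeasureTheory.volume a b :=
    ContinuousOn.intervalIntegrable (hu ▸ hf)
  have hg' : IntervalIntegrable g MeasureTheory.volume a b :=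
    ContinuousOn.intervalIntegrable (hu ▸ hg)
  have hfg' : IntervalIntegrable (fun x ↦ f x * g x) MeasureTheory.volume a b :=
    ContinuousOn.intervalIntegrable (hu ▸ hf.mul hg)
  obtain ⟨c, hc, hgc⟩ := exists_eq_interval_average hab.ne (hu ▸ hg)
  have hc' : c ∈ Set.Icc a b := hu ▸ Set.uIoo_subset_uIcc_self hc
  have hmean : (b - a) * g c = ∫ x in a..b, g x := by
    rw [hgc, interval_average_eq, smul_eq_mul, mul_inv_cancel_left₀ (sub_ne_zero.2 hab.ne')]
  have hle : ∫ x in a..b, f x * g x ≤ ∫ x in a..b, (f x * g c + f c * (g x - g c)) := by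
    refine intervalIntegral.integral_mono_on hab.le hfg' ?_ fun x hx ↦ ?_
    · exact (hf'.mul_const _).add ((hg'.sub intervalIntegrable_const).const_mul _)
    · rcases lt_trichotomy (g x) (g c) with h | h | h
      · nlinarith [hfg hx hc' h]
      · simp [h]
      · nlinarith [hfg hc' hx h]
  rw [intervalIntegral.integral_add (hf'.mul_const _)
      ((hg'.sub intervalIntegrable_const).const_mul _),
    intervalIntegral.integral_mul_const, intervalIntegral.integral_const_mul,
    intervalIntegral.integral_sub hg' intervalIntegrable_const, intervalIntegral.integral_const,
    smul_eq_mul, hmean, sub_self, mul_zero, add_zero] at hle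
  calc (b - a) * ∫ x in a..b, f x * g x
      ≤ (b - a) * ((∫ x in a..b, f x) * g c) :=
        mul_le_mul_of_nonneg_left hle (sub_nonneg.2 hab.le)
    _ = (∫ x in a..b, f x) * ∫ x in a..b, g x := by rw [← hmean]; ring

theorem integral_sub_div_sub_pow {a b : ℝ} (hab : a ≠ b) (n : ℕ) :
    ∫ x in a..b, ((x - a) / (b - a)) ^ n = (b - a) / (n + 1) := by
  have h : b - a ≠ 0 := sub_ne_zero.2 hab.symm
  simp_rw [div_pow]
  rw [intervalIntegral.integral_div, intervalIntegral.integral_comp_sub_right (fun x ↦ x ^ n),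
    integral_pow, sub_self, zero_pow n.succ_ne_zero]
  field_simp
  ring

/-- For `0 < q < 1` and an integer `j ≥ 1`,
`∫_q^1 (1/z)·((z-q)/(1-q))^(j-1) dz ≤ (-ln q)/j`. -/
theorem chebyshev_integral_step (q : ℝ) (hq0 : 0 < q) (hq1 : q < 1) (j : ℕ) (hj : 1 ≤ j) :
    (∫ z in q..1, (1 / z) * ((z - q) / (1 - q)) ^ (j - 1)) ≤ (-Real.log q) / j := by
  obtain ⟨n, rfl⟩ := Nat.exists_eq_add_of_le' hj
  rw [Nat.add_sub_cancel]
  have h1q : 0 < 1 - q := sub_pos.2 hq1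
  have hanti : AntitoneOn (fun z : ℝ ↦ 1 / z) (Set.Icc q 1) := fun x hx y _ hxy ↦
    one_div_le_one_div_of_le (hq0.trans_le hx.1) hxy
  have hmono : MonotoneOn (fun z : ℝ ↦ ((z - q) / (1 - q)) ^ n) (Set.Icc q 1) := by
    intro x hx y _ hxy
    have hx0 : 0 ≤ (x - q) / (1 - q) := div_nonneg (sub_nonneg.2 hx.1) h1q.le
    dsimp only
    gcongr
  have hcont : ContinuousOn (fun z : ℝ ↦ 1 / z) (Set.Icc q 1) :=
    continuousOn_const.div continuousOn_id fun x hx ↦ (hq0.trans_le hx.1).ne'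
  have key := (hanti.antivaryOn hmono).sub_mul_intervalIntegral_mul_le hq1 hcont
    (by fun_prop)
  rw [integral_sub_div_sub_pow hq1.ne, integral_one_div_of_pos hq0 one_pos, one_div,
    Real.log_inv] at key
  refine le_of_mul_le_mul_left (key.trans_eq ?_) h1q
  push_cast
  ring
end

section
/- Let 0 < c < 1, let τ_j and τ_m be reals with 0 < τ_j < 1, 1 − c < τ_m, τ_m ≤ 1, and c > 1 − τ_j, and set q = (c − (1 − τ_j))/τ_j. Then for every z with q ≤ z ≤ 1, ln( τ_m / (c − z·τ_j − (1 − τ_j − τ_m)) ) ≤ ((z − q)/(1 − q)) · ln( τ_m / (c − (1 − τ_m)) ). -/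
/-- The Jensen's-inequality step: for `0 < c < 1`, `0 < τⱼ < 1`, `1 - c < τₘ ≤ 1`,
`c > 1 - τⱼ`, and `q = (c - (1 - τⱼ))/τⱼ`, for every `z ∈ [q, 1]`,
`ln(τₘ/(c - z·τⱼ - (1 - τⱼ - τₘ))) ≤ ((z - q)/(1 - q))·ln(τₘ/(c - (1 - τₘ)))`. -/
theorem jensen_log_step (c τj τm : ℝ) (hc0 : 0 < c) (hc1 : c < 1)
    (hτj0 : 0 < τj) (hτj1 : τj < 1) (hτm : 1 - c < τm) (hτm1 : τm ≤ 1)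
    (hcτj : c > 1 - τj) (q : ℝ) (hq : q = (c - (1 - τj)) / τj) :
    ∀ z : ℝ, q ≤ z → z ≤ 1 →
      Real.log (τm / (c - z * τj - (1 - τj - τm))) ≤
        ((z - q) / (1 - q)) * Real.log (τm / (c - (1 - τm))) := by
  intro z hz hz1
  have hqτ : q * τj = c - (1 - τj) := by rw [hq]; field_simp
  have hq1 : 0 < 1 - q := by
    rw [hq, sub_pos, div_lt_one hτj0]; linarith
  have hτm0 : 0 < τm := by linarith
  have hB : 0 < c - (1 - τm) := by linarith
  set t := (z - q) / (1 - q) with ht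
  have ht0 : 0 ≤ t := div_nonneg (by linarith) hq1.le
  have ht1 : t ≤ 1 := (div_le_one hq1).2 (by linarith)
  have htz : t * (1 - q) = z - q := div_mul_cancel₀ _ hq1.ne'
  have hD : c - z * τj - (1 - τj - τm) = (1 - t) * τm + t * (c - (1 - τm)) := by
    linear_combination τj * htz + (t - 1) * hqτ
  have hconc := strictConcaveOn_log_Ioi.concaveOn.2 (Set.mem_Ioi.2 hτm0) (Set.mem_Ioi.2 hB)
    (sub_nonneg.2 ht1) ht0 (sub_add_cancel 1 t)
  simp only [smul_eq_mul] at hconc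
  have hDpos : 0 < (1 - t) * τm + t * (c - (1 - τm)) := by
    rw [← hD]
    nlinarith [mul_le_mul_of_nonneg_right hz1 hτj0.le]
  rw [hD, Real.log_div hτm0.ne' hDpos.ne', Real.log_div hτm0.ne' hB.ne']
  linarith
end
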